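/- arXiv:1206.4707 — 2 statements merged into one kernel-verified Lean document; each statement's English description precedes it below -/
import Mathlib

section
/- Let h : ℝ² → ℝ² be an orientation-preserving homeomorphism and γ a translation arc for h. Then for every integer N ≥ 1, either γ is an N-translation arc for h, or the set Γ = ⋃_{k=0}^{N} h^k(γ) contains a loop that is homotopically nontrivial in ℝ²∖Fix(h): there exist a point z ∈ ℝ²∖Fix(h) and a loop δ : [0,1] → ℝ²∖Fix(h) with δ(0) = δ(1) = z and image contained in Γ, such that δ is not homotopic (rel endpoints) to the constant loop at z within ℝ²∖Fix(h). (Here Fix(h) denotes the fixed point set of h; note that Γ is automatically disjoint from Fix(h).) -/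
open Set Topology Filter

noncomputable section

universe u

variable {X : Type u} [TopologicalSpace X]

/-- A homeomorphism is *orientation preserving* if it is isotopic to the identity. -/
def IsOrientationPreserving (f : X ≃ₜ X) : Prop :=
  ∃ H : unitInterval × X → X,
    Continuous H ∧ (∀ x, H (0, x) = x) ∧ (∀ x, H (1, x) = f x) ∧
      ∀ t : unitInterval, IsHomeomorph fun x => H (t, x)

/-- `D` is a connected component of `A`. -/
def IsCompOf (A D : Set X) : Prop := ∃ x ∈ A, D = connectedComponentIn A x

/-- `A` has exactly two connected components, the distinct sets `D₁` and `D₂`. -/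
def HasTwoComps (A D₁ D₂ : Set X) : Prop :=
  IsCompOf A D₁ ∧ IsCompOf A D₂ ∧ D₁ ≠ D₂ ∧
    ∀ x ∈ A, connectedComponentIn A x = D₁ ∨ connectedComponentIn A x = D₂

/-- A *cross-cut* of the open set `U`: the image of an arc `g` on `(0,1)`, where `g` is
continuous and injective on `[0,1]`'s interior, runs inside `U`, has endpoints on `∂U`, and
separates `U` into exactly two components, each with a boundary point on `∂U` away from the
closed arc. -/
def IsCrossCut (U γ : Set X) : Prop :=
  ∃ g : ℝ → X,
    ContinuousOn g (Icc 0 1) ∧ InjOn g (Ioo 0 1) ∧ (∀ t ∈ Ioo (0:ℝ) 1, g t ∈ U) ∧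
      g 0 ∈ frontier U ∧ g 1 ∈ frontier U ∧ γ = g '' Ioo 0 1 ∧
      ∃ D₁ D₂ : Set X, HasTwoComps (U \ γ) D₁ D₂ ∧
        (frontier D₁ ∩ (frontier U \ g '' Icc 0 1)).Nonempty ∧
        (frontier D₂ ∩ (frontier U \ g '' Icc 0 1)).Nonempty

/-- A *cross-section* of `U`: a connected component of `U ∖ γ` for a cross-cut `γ`. -/
def IsCrossSection (U D : Set X) : Prop := ∃ γ : Set X, IsCrossCut U γ ∧ IsCompOf (U \ γ) D

/-- The image of a set under the `k`-th integer iterate of a homeomorphism. -/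
def iterZ (f : X ≃ₜ X) (k : ℤ) (A : Set X) : Set X := ⇑(f.toEquiv ^ k) '' A

/-- A cross-section of `U` which is wandering for `f^n`. -/
def IsWanderingSection (f : X ≃ₜ X) (U : Set X) (n : ℕ) (D : Set X) : Prop :=
  IsCrossSection U D ∧ ∀ k : ℤ, k ≠ 0 → iterZ f ((n : ℤ) * k) D ∩ D = ∅

/-- `f` is ∂-nonwandering in `U`. -/
def BdNonwandering (f : X ≃ₜ X) (U : Set X) : Prop :=
  ∀ n : ℕ, 1 ≤ n → ∃ K : Set X, IsCompact K ∧ K ⊆ U ∧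
    ∀ D : Set X, IsWanderingSection f U n D →
      (∃ k : ℤ, 0 < k ∧ (iterZ f ((n : ℤ) * k) D ∩ K).Nonempty) ∧
      (∃ k : ℤ, k < 0 ∧ (iterZ f ((n : ℤ) * k) D ∩ K).Nonempty)

/-- The boundary of `D` inside `U` (for `D` open in `U`). -/
def bdIn (U D : Set X) : Set X := (closure D \ D) ∩ U

/-- A chain of cross-sections of `U`. -/
def IsPEChain (U : Set X) (D : ℕ → Set X) : Prop :=
  (∀ i, IsCrossSection U (D i)) ∧ (∀ i j : ℕ, j ≤ i → D i ⊆ D j) ∧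
    ∀ i j : ℕ, i ≠ j → closure (bdIn U (D i)) ∩ closure (bdIn U (D j)) = ∅

/-- The chain `D` divides the cross-section `E`. -/
def ChainDividesSection (D : ℕ → Set X) (E : Set X) : Prop := ∃ N : ℕ, ∀ i, N ≤ i → D i ⊆ E

/-- The chain `D` divides the chain `D'`. -/
def ChainDivides (D D' : ℕ → Set X) : Prop := ∀ n : ℕ, ∃ m : ℕ, D m ⊆ D' n

/-- A prime chain: a chain dividing every chain that divides it. -/
def IsPrimeChain (U : Set X) (D : ℕ → Set X) : Prop :=
  IsPEChain U D ∧ ∀ D' : ℕ → Set X, IsPEChain U D' → ChainDivides D' D → ChainDivides D D'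

/-- The type of prime chains of `U`. -/
def PrimeChain (U : Set X) : Type u := {D : ℕ → Set X // IsPrimeChain U D}

/-- A prime end of `U`: an equivalence class of prime chains. -/
def PrimeEnd (U : Set X) : Type u :=
  Quot fun C C' : PrimeChain U => ChainDivides C.1 C'.1 ∧ ChainDivides C'.1 C.1

/-- The prime end `p` divides the cross-section `E`. -/
def PrimeEndDivides {U : Set X} (p : PrimeEnd U) (E : Set X) : Prop :=
  ∃ C : PrimeChain U, Quot.mk _ C = p ∧ ChainDividesSection C.1 E

/-- The prime ends compactification of `U` (as a set: `U ⊔ (prime ends)`). -/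
def PrimeEndComp (U : Set X) : Type u := ↥U ⊕ PrimeEnd U

/-- A point of `U`, as an element of the prime ends compactification. -/
def pePt (U : Set X) (x : ↥U) : PrimeEndComp U := Sum.inl x

/-- A prime end, as an element of the prime ends compactification. -/
def peEnd (U : Set X) (p : PrimeEnd U) : PrimeEndComp U := Sum.inr p

/-- The copy of a subset `V ⊆ U` inside the prime ends compactification. -/
def peOpen (U V : Set X) : Set (PrimeEndComp U) := {z | ∃ x : ↥U, z = pePt U x ∧ (x : X) ∈ V}

/-- The basic set `E ∪ i_E(E)` of the prime ends compactification, for a cross-section `E`. -/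
def peSection (U E : Set X) : Set (PrimeEndComp U) :=
  peOpen U E ∪ {z | ∃ p : PrimeEnd U, z = peEnd U p ∧ PrimeEndDivides p E}

/-- The topology of the prime ends compactification. -/
instance primeEndCompTopology (U : Set X) : TopologicalSpace (PrimeEndComp U) :=
  TopologicalSpace.generateFrom
    ({s | ∃ V : Set X, IsOpen V ∧ V ⊆ U ∧ s = peOpen U V} ∪
      {s | ∃ E : Set X, IsCrossSection U E ∧ s = peSection U E})

/-- The circle of prime ends, as a subset of the prime ends compactification. -/
def PrimeEndCircle (U : Set X) : Set (PrimeEndComp U) := Set.range (peEnd U)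

/-- `F` is an extension of `f|_U` to the prime ends compactification of `U`. -/
def IsPEExtension (f : X ≃ₜ X) (U : Set X) (F : PrimeEndComp U ≃ₜ PrimeEndComp U) : Prop :=
  ∀ (x : X) (hx : x ∈ U) (hfx : f x ∈ U), F (pePt U ⟨x, hx⟩) = pePt U ⟨f x, hfx⟩

/-- An end-cut of `U`: an injective arc in `U` defined on `[0,1)` converging in the ambient
space as `t → 1⁻`. -/
def IsEndCut (U : Set X) (γ : ℝ → X) : Prop :=
  ContinuousOn γ (Ico 0 1) ∧ InjOn γ (Ico 0 1) ∧ (∀ t ∈ Ico (0:ℝ) 1, γ t ∈ U) ∧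
    ∃ z : X, Tendsto γ (𝓝[<] (1:ℝ)) (𝓝 z)

/-- `z` is an accessible point of `∂U`. -/
def IsAccessiblePoint (U : Set X) (z : X) : Prop :=
  ∃ γ : ℝ → X, IsEndCut U γ ∧ Tendsto γ (𝓝[<] (1:ℝ)) (𝓝 z)

/-- `p` is an accessible prime end of `U`. -/
def IsAccessiblePrimeEnd (U : Set X) (p : PrimeEnd U) : Prop :=
  ∃ (γ : ℝ → X) (hγ : ∀ t ∈ Ico (0:ℝ) 1, γ t ∈ U), IsEndCut U γ ∧
    Tendsto (fun t : ↥(Ico (0:ℝ) 1) => pePt U ⟨γ ↑t, hγ ↑t t.2⟩)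
      (comap Subtype.val (𝓝[<] (1:ℝ))) (𝓝 (peEnd U p))

/-- A translation arc for `f` based at `x`: a simple arc from `x` to `f x` meeting its image
only as allowed. -/
def IsTranslationArc (f : X ≃ₜ X) (γ : Set X) (x : X) : Prop :=
  f x ≠ x ∧
    ∃ g : ℝ → X, ContinuousOn g (Icc 0 1) ∧ InjOn g (Icc 0 1) ∧
      g 0 = x ∧ g 1 = f x ∧ γ = g '' Icc 0 1 ∧
      ((⇑f '' γ) ∩ γ = {f x} ∨ ((⇑f '' γ) ∩ γ = {x, f x} ∧ f (f x) = x))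

/-- An `N`-translation arc for `f` based at `x` (for `N = 1` this is just a translation arc). -/
def IsNTranslationArc (f : X ≃ₜ X) (N : ℕ) (γ : Set X) (x : X) : Prop :=
  IsTranslationArc f γ x ∧
    (2 ≤ N →
      (∀ k : ℕ, 2 ≤ k → k ≤ N - 1 → (⇑f)^[k] '' γ ∩ γ = ∅) ∧
        ((⇑f)^[N] '' γ ∩ γ = ∅ ∨ ((⇑f)^[N] '' γ ∩ γ = {x} ∧ (⇑f)^[N + 1] x = x)))

/-- An ∞-translation arc: an `N`-translation arc for every `N ≥ 1`. -/
def IsInfTranslationArc (f : X ≃ₜ X) (γ : Set X) (x : X) : Prop :=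
  ∀ N : ℕ, 1 ≤ N → IsNTranslationArc f N γ x

/-- A nonwandering homeomorphism. -/
def IsNonwanderingMap (f : X → X) : Prop :=
  ∀ V : Set X, IsOpen V → V.Nonempty → ∃ n : ℕ, 1 ≤ n ∧ (f^[n] '' V ∩ V).Nonempty

/-- A loop contained in `A` which is not null-homotopic in `V`. -/
def IsEssentialLoopIn (V A : Set X) : Prop :=
  ∃ (z : ↥V) (δ : Path z z), (∀ t : unitInterval, (↑(δ t) : X) ∈ A) ∧
    ¬ δ.Homotopic (Path.refl z)

/-- An annular continuum: a continuum with an open annular neighborhood `V` such that `V ∖ K`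
has exactly two components, each essential in `V`. -/
def IsAnnularContinuum (K : Set X) : Prop :=
  IsCompact K ∧ IsConnected K ∧ K.Nontrivial ∧
    ∃ V : Set X, IsOpen V ∧ K ⊆ V ∧
      Nonempty (↥V ≃ₜ AddCircle (1 : ℝ) × ↥(Ioo (0 : ℝ) 1)) ∧
      ∃ D₁ D₂ : Set X, HasTwoComps (V \ K) D₁ D₂ ∧
        IsEssentialLoopIn V D₁ ∧ IsEssentialLoopIn V D₂

/-- A set contractible in the ambient surface: it has an open neighborhood homeomorphic to the
plane. -/
def ContractibleInSurface (K : Set X) : Prop :=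
  ∃ W : Set X, IsOpen W ∧ K ⊆ W ∧ Nonempty (↥W ≃ₜ (ℝ × ℝ))

/-- `α ∈ ℝ/ℤ` is rational. -/
def IsRationalAC (α : AddCircle (1 : ℝ)) : Prop := ∃ r : ℚ, α = ((r : ℝ) : AddCircle (1 : ℝ))

/-- The constant `q(α,g)`: the smallest positive integer `q` with `‖qα‖ = 0` if `α` is
rational, and `(2g+1)‖qα‖ < ‖α‖` if `α` is irrational. -/
def qConst (α : AddCircle (1 : ℝ)) (g : ℕ) : ℕ :=
  sInf {q : ℕ | 0 < q ∧
    ((IsRationalAC α ∧ ‖q • α‖ = 0) ∨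
      (¬IsRationalAC α ∧ ((2 * g + 1 : ℕ) : ℝ) * ‖q • α‖ < ‖α‖))}


/-- A nonvanishing continuous function on a convex set has a continuous logarithm. -/
theorem Convex.exists_continuousOn_exp_eq {E : Type*} [AddCommGroup E] [Module ℝ E]
    [TopologicalSpace E] [IsTopologicalAddGroup E] [ContinuousSMul ℝ E] {S : Set E}
    (hS : Convex ℝ S) {f : E → ℂ} (hf : ContinuousOn f S) (hf0 : ∀ x ∈ S, f x ≠ 0) :
    ∃ L : E → ℂ, ContinuousOn L S ∧ ∀ x ∈ S, Complex.exp (L x) = f x := by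
  classical
  rcases S.eq_empty_or_nonempty with rfl | ⟨x₀, hx₀⟩
  · exact ⟨0, continuousOn_empty _, by simp⟩
  have hmem (p : unitInterval × S) : x₀ + (p.1 : ℝ) • ((p.2 : E) - x₀) ∈ S :=
    hS.add_smul_sub_mem hx₀ p.2.2 p.1.2
  let F : C(unitInterval × S, {z : ℂ // z ≠ 0}) :=
    ⟨fun p ↦ ⟨f (x₀ + (p.1 : ℝ) • ((p.2 : E) - x₀)), hf0 _ (hmem p)⟩, by
      refine Continuous.subtype_mk (hf.comp_continuous ?_ hmem) _
      fun_prop⟩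
  have hF0 (a : S) : F (0, a) =
      (fun z : ℂ ↦ (⟨_, z.exp_ne_zero⟩ : {z : ℂ // z ≠ 0})) (Complex.log (f x₀)) := by
    apply Subtype.ext
    simp [F, Complex.exp_log (hf0 x₀ hx₀)]
  let Λ := Complex.isCoveringMap_exp.liftHomotopy F (ContinuousMap.const S (Complex.log (f x₀))) hF0
  have hΛ (a : S) : Complex.exp (Λ (1, a)) = f a := by
    have := congr_arg Subtype.val (congr_fun (Complex.isCoveringMap_exp.liftHomotopy_lifts F
      (ContinuousMap.const S (Complex.log (f x₀))) hF0) (1, a))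
    simpa [F, Λ] using this
  refine ⟨fun x ↦ if h : x ∈ S then Λ (1, ⟨x, h⟩) else 0, ?_, fun x hx ↦ ?_⟩
  · rw [continuousOn_iff_continuous_domRestrict]
    refine (Λ.continuous.comp (Continuous.prodMk_right 1)).congr fun a ↦ ?_
    simp
  · simpa [hx] using hΛ ⟨x, hx⟩

/-- A continuous function on a preconnected set whose exponential is constant is constant. -/
theorem IsPreconnected.eq_of_exp_eq {α : Type*} [TopologicalSpace α] {S : Set α}
    (hS : IsPreconnected S) {g : α → ℂ} (hg : ContinuousOn g S) {w : ℂ}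
    (hw : ∀ x ∈ S, Complex.exp (g x) = w) {x y : α} (hx : x ∈ S) (hy : y ∈ S) : g x = g y := by
  have hsub : (g '' S).Countable := by
    refine (Set.countable_range fun n : ℤ ↦ g x + n * (2 * Real.pi * Complex.I)).mono ?_
    rintro _ ⟨z, hz, rfl⟩
    obtain ⟨n, hn⟩ := Complex.exp_eq_exp_iff_exists_int.1 ((hw z hz).trans (hw x hx).symm)
    exact ⟨n, hn.symm⟩
  exact hsub.isTotallyDisconnected _ Subset.rfl (hS.image g hg)
    (mem_image_of_mem g hx) (mem_image_of_mem g hy)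

/-- Two continuous logarithms of the same function have the same increments. -/
theorem IsPreconnected.sub_eq_sub_of_exp_eq {α : Type*} [TopologicalSpace α] {S : Set α}
    (hS : IsPreconnected S) {f g : α → ℂ} (hf : ContinuousOn f S) (hg : ContinuousOn g S)
    (hfg : ∀ x ∈ S, Complex.exp (f x) = Complex.exp (g x)) {x y : α} (hx : x ∈ S) (hy : y ∈ S) :
    f x - f y = g x - g y := by
  have := hS.eq_of_exp_eq (hf.sub hg) (w := 1)
    (fun z hz ↦ by rw [Pi.sub_apply, Complex.exp_sub, hfg z hz, div_self (Complex.exp_ne_zero _)])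
    hx hy
  simp only [Pi.sub_apply] at this
  linear_combination this

/-- Along a null-homotopic loop, a continuous logarithm of a nonvanishing function closes up. -/
theorem Path.Homotopic.exp_lift_eq {Y : Type*} [TopologicalSpace Y] {z : Y} {δ : Path z z}
    (hδ : δ.Homotopic (Path.refl z)) {φ : Y → ℂ} (hφ : Continuous φ) (hφ0 : ∀ y, φ y ≠ 0)
    {ω : unitInterval → ℂ} (hω : Continuous ω) (hexp : ∀ a, Complex.exp (ω a) = φ (δ a)) :
    ω 1 = ω 0 := by
  let ψ : C(Y, {z : ℂ // z ≠ 0}) := ⟨fun y ↦ ⟨φ y, hφ0 y⟩, hφ.subtype_mk _⟩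
  have hcov := Complex.isCoveringMap_exp
  have hrel := hδ.map ψ
  have h0 : ψ z = (fun z : ℂ ↦ (⟨_, z.exp_ne_zero⟩ : {z : ℂ // z ≠ 0})) (ω 0) :=
    Subtype.ext (by simp [ψ, hexp])
  have key := hcov.liftPath_apply_one_eq_of_homotopicRel hrel (ω 0) (by simpa using h0)
    (by simpa using h0)
  have e1 : (⟨ω, hω⟩ : C(unitInterval, ℂ)) = hcov.liftPath (δ.map ψ.continuous).toContinuousMap (ω 0)
      (by simpa using h0) :=
    (hcov.eq_liftPath_iff' _).2 ⟨funext fun a ↦ Subtype.ext (by simp [ψ, hexp]), rfl⟩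
  have e2 : ContinuousMap.const _ (ω 0) = hcov.liftPath ((Path.refl z).map ψ.continuous).toContinuousMap
      (ω 0)
      (by simpa using h0) :=
    (hcov.eq_liftPath_iff' _).2 ⟨funext fun a ↦ by simpa using h0.symm, rfl⟩
  exact (DFunLike.congr_fun e1 1).trans (key.trans (DFunLike.congr_fun e2 1).symm)

/-- Let `G (τ, ·)` be an isotopy of simple closed curves, parametrized by `[t, s]`, from a curve
to its image, which is parametrized by a unit shift. Then the displacement along the curve has
nonzero winding number. -/
theorem displacement_log_ne {G : ℝ × ℝ → ℂ} (hG : Continuous G) {t s : ℝ} (hts : t + 1 < s)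
    (hinj : ∀ τ ∈ Icc (0 : ℝ) 1, ∀ u v, t ≤ u → u < v → v ≤ s → v - u < s - t →
      G (τ, u) ≠ G (τ, v))
    (hclosed : ∀ τ ∈ Icc (0 : ℝ) 1, G (τ, t) = G (τ, s))
    (hshift : ∀ u, G (1, u) = G (0, u + 1))
    (hQ : ∀ a b : ℝ, 0 ≤ b → b ≤ a → a ≤ 1 →
      G (0, (1 - a) * (s - 1) + a * (t + 1)) ≠ G (0, (1 - b) * (s - 1) + b * (t + 1) + 1))
    {ω : ℝ → ℂ} (hω : Continuous ω) (hexp : ∀ u, Complex.exp (ω u) = G (0, u + 1) - G (0, u)) :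
    ω s ≠ ω t := by
  have h0 : (0 : ℝ) ∈ Icc (0 : ℝ) 1 := by simp
  have h1 : (1 : ℝ) ∈ Icc (0 : ℝ) 1 := by simp
  let S : Set (ℝ × ℝ × ℝ) := {p | 0 ≤ p.1 ∧ p.1 ≤ 1 ∧ t ≤ p.2.1 ∧ p.2.1 < p.2.2 ∧ p.2.2 ≤ s ∧
    p.2.2 - p.2.1 < s - t}
  have hSconv : Convex ℝ S := by
    rw [convex_iff_forall_pos]
    rintro ⟨a, b, c⟩ ⟨h1, h2, h3, h4, h5, h6⟩ ⟨a', b', c'⟩ ⟨h1', h2', h3', h4', h5', h6'⟩ p q hp hq hpq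
    obtain rfl : q = 1 - p := by linarith
    simp only at h1 h2 h3 h4 h5 h6 h1' h2' h3' h4' h5' h6'
    refine ⟨?_, ?_, ?_, ?_, ?_, ?_⟩ <;> simp only [Prod.smul_mk, Prod.mk_add_mk, smul_eq_mul] <;>
      nlinarith
  obtain ⟨Θ, hΘc, hΘ⟩ := hSconv.exists_continuousOn_exp_eq
    (f := fun p ↦ G (p.1, p.2.2) - G (p.1, p.2.1)) (by fun_prop)
    (fun p ⟨h1, h2, h3, h4, h5, h6⟩ ↦
      sub_ne_zero.2 (hinj p.1 ⟨h1, h2⟩ _ _ h3 h4 h5 h6).symm)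
  let ℓ : ℝ → ℝ := fun a ↦ (1 - a) * (s - 1) + a * (t + 1)
  have hℓc : Continuous ℓ := by fun_prop
  have hℓ0 : ℓ 0 = s - 1 := by simp [ℓ]
  have hℓ1 : ℓ 1 = t + 1 := by simp [ℓ]
  have hℓt : ∀ a ∈ Icc (0 : ℝ) 1, t < ℓ a := fun a ha ↦ by
    simp only [ℓ]
    rcases ha.1.eq_or_lt with rfl | h
    · linarith
    · nlinarith [ha.2]
  have hℓs : ∀ a ∈ Icc (0 : ℝ) 1, ℓ a < s := fun a ha ↦ by
    simp only [ℓ]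
    rcases ha.1.eq_or_lt with rfl | h
    · linarith
    · nlinarith [ha.2]
  let Q : Set (ℝ × ℝ) := {p | 0 ≤ p.2 ∧ p.2 ≤ p.1 ∧ p.1 ≤ 1}
  have hQconv : Convex ℝ Q := by
    rintro ⟨a, b⟩ ⟨h1, h2, h3⟩ ⟨a', b'⟩ ⟨h1', h2', h3'⟩ p q hp hq hpq
    obtain rfl : q = 1 - p := by linarith
    simp only at h1 h2 h3 h1' h2' h3'
    refine ⟨?_, ?_, ?_⟩ <;> simp only [Prod.smul_mk, Prod.mk_add_mk, smul_eq_mul] <;> nlinarith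
  obtain ⟨Λ, hΛc, hΛ⟩ := hQconv.exists_continuousOn_exp_eq
    (f := fun p ↦ G (0, ℓ p.2 + 1) - G (0, ℓ p.1)) (by fun_prop)
    (fun p ⟨h1, h2, h3⟩ ↦ sub_ne_zero.2 (hQ p.1 p.2 h1 h2 h3).symm)
  have hconn : IsPreconnected (Icc (0 : ℝ) 1) := isPreconnected_Icc
  have hconn' : IsPreconnected (Icc t (s - 1)) := isPreconnected_Icc
  have htm : t ∈ Icc t (s - 1) := ⟨le_rfl, by linarith⟩
  have hsm : s - 1 ∈ Icc t (s - 1) := ⟨by linarith, le_rfl⟩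
  have first : ω (s - 1) - ω t = Θ (0, s - 1, s - 1 + 1) - Θ (0, t, t + 1) := by
    have hm : ∀ u ∈ Icc t (s - 1), ((0 : ℝ), u, u + 1) ∈ S := fun u hu ↦
      ⟨le_rfl, zero_le_one, hu.1, by simp, by simp; linarith [hu.2], by simp; linarith⟩
    refine hconn'.sub_eq_sub_of_exp_eq (g := fun u ↦ Θ (0, u, u + 1)) hω.continuousOn
      (hΘc.comp (by fun_prop) hm) (fun u hu ↦ ?_) hsm htm
    rw [hexp, hΘ _ (hm u hu)]
  have last : ω (s - 1 + 1) - ω (t + 1) = Θ (1, s - 1, s - 1 + 1) - Θ (1, t, t + 1) := by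
    have hm : ∀ u ∈ Icc t (s - 1), ((1 : ℝ), u, u + 1) ∈ S := fun u hu ↦
      ⟨zero_le_one, le_rfl, hu.1, by simp, by simp; linarith [hu.2], by simp; linarith⟩
    refine hconn'.sub_eq_sub_of_exp_eq (f := fun u ↦ ω (u + 1)) (g := fun u ↦ Θ (1, u, u + 1))
      (by fun_prop) (hΘc.comp (by fun_prop) hm) (fun u hu ↦ ?_) hsm htm
    rw [hexp, hΘ _ (hm u hu), hshift, hshift]
  have middle : ω (ℓ 1) - ω (ℓ 0) = Λ (1, 1) - Λ (0, 0) := by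
    have hm : ∀ a ∈ Icc (0 : ℝ) 1, (a, a) ∈ Q := fun a ha ↦ ⟨ha.1, le_rfl, ha.2⟩
    refine hconn.sub_eq_sub_of_exp_eq (f := fun a ↦ ω (ℓ a)) (g := fun a ↦ Λ (a, a))
      (by fun_prop) (hΛc.comp (by fun_prop) hm) (fun a ha ↦ ?_) h1 h0
    rw [hexp, hΛ _ (hm a ha)]
  have horizontal : Λ (1, 0) - Λ (0, 0) = Θ (0, ℓ 1, s) - Θ (0, ℓ 0, s) := by
    have hm : ∀ a ∈ Icc (0 : ℝ) 1, (a, (0 : ℝ)) ∈ Q := fun a ha ↦ ⟨le_rfl, ha.1, ha.2⟩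
    have hm' : ∀ a ∈ Icc (0 : ℝ) 1, ((0 : ℝ), ℓ a, s) ∈ S := fun a ha ↦
      ⟨le_rfl, zero_le_one, (hℓt a ha).le, hℓs a ha, le_rfl, sub_lt_sub_left (hℓt a ha) s⟩
    refine hconn.sub_eq_sub_of_exp_eq (f := fun a ↦ Λ (a, 0)) (g := fun a ↦ Θ (0, ℓ a, s))
      (hΛc.comp (by fun_prop) hm) (hΘc.comp (by fun_prop) hm') (fun a ha ↦ ?_) h1 h0
    rw [hΛ _ (hm a ha), hΘ _ (hm' a ha)]
    simp [hℓ0]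
  have vertical : Λ (1, 1) - Λ (1, 0) = Θ (1, t, ℓ 1) - Θ (1, t, ℓ 0) := by
    have hm : ∀ a ∈ Icc (0 : ℝ) 1, ((1 : ℝ), a) ∈ Q := fun a ha ↦ ⟨ha.1, ha.2, le_rfl⟩
    have hm' : ∀ a ∈ Icc (0 : ℝ) 1, ((1 : ℝ), t, ℓ a) ∈ S := fun a ha ↦
      ⟨zero_le_one, le_rfl, le_rfl, hℓt a ha, (hℓs a ha).le, sub_lt_sub_right (hℓs a ha) t⟩
    refine hconn.sub_eq_sub_of_exp_eq (f := fun a ↦ Λ (1, a)) (g := fun a ↦ Θ (1, t, ℓ a))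
      (hΛc.comp (by fun_prop) hm) (hΘc.comp (by fun_prop) hm') (fun a ha ↦ ?_) h1 h0
    rw [hΛ _ (hm a ha), hΘ _ (hm' a ha)]
    simp [hℓ1, hshift]
  let κ : ℝ × ℝ → ℂ := fun p ↦ Θ (p.1, p.2, s) - Θ (p.1, t, p.2)
  have hmr : ∀ p ∈ Icc (0 : ℝ) 1 ×ˢ Ioo t s, (p.1, p.2, s) ∈ S := fun p hp ↦
    ⟨hp.1.1, hp.1.2, hp.2.1.le, hp.2.2, le_rfl, sub_lt_sub_left hp.2.1 s⟩
  have hml : ∀ p ∈ Icc (0 : ℝ) 1 ×ˢ Ioo t s, (p.1, t, p.2) ∈ S := fun p hp ↦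
    ⟨hp.1.1, hp.1.2, le_rfl, hp.2.1, hp.2.2.le, sub_lt_sub_right hp.2.2 t⟩
  have hκ : ∀ p ∈ Icc (0 : ℝ) 1 ×ˢ Ioo t s, Complex.exp (κ p) = -1 := fun p hp ↦ by
    have hne := Complex.exp_ne_zero (Θ (p.1, t, p.2))
    rw [hΘ _ (hml p hp)] at hne
    simp only [κ]
    rw [Complex.exp_sub, hΘ _ (hmr p hp), hΘ _ (hml p hp), div_eq_iff hne]
    simp only [hclosed p.1 hp.1]
    ring
  have hsp : ((1 : ℝ), s - 1) ∈ Icc (0 : ℝ) 1 ×ˢ Ioo t s := ⟨h1, by simp; linarith, by simp⟩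
  have htp : ((0 : ℝ), t + 1) ∈ Icc (0 : ℝ) 1 ×ˢ Ioo t s := ⟨h0, by simp, hts⟩
  have hκeq : κ (1, s - 1) = κ (0, t + 1) :=
    (isPreconnected_Icc.prod isPreconnected_Ioo).eq_of_exp_eq
      ((hΘc.comp (by fun_prop) hmr).sub (hΘc.comp (by fun_prop) hml)) hκ hsp htp
  have hκ0 : κ (0, t + 1) ≠ 0 := fun h ↦ by
    have := hκ _ htp
    rw [h, Complex.exp_zero] at this
    norm_num at this
  have hsum : ω s - ω t = κ (1, s - 1) + κ (0, t + 1) := by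
    simp only [hℓ0, hℓ1, sub_add_cancel] at first last middle horizontal vertical
    simp only [κ]
    linear_combination first + last + middle + horizontal + vertical
  intro h
  apply hκ0
  rw [h, sub_self, hκeq] at hsum
  linear_combination -hsum / 2

/-- An arc from a point to its image extends to an equivariant curve. -/
theorem exists_equivariant_curve {Y : Type*} [TopologicalSpace Y] (h : Y ≃ₜ Y) {g : ℝ → Y}
    (hg : ContinuousOn g (Icc 0 1)) (hg1 : g 1 = h (g 0)) :
    ∃ c : ℝ → Y, Continuous c ∧ (∀ u, c (u + 1) = h (c u)) ∧ ∀ u ∈ Icc (0 : ℝ) 1, c u = g u := by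
  let c : ℝ → Y := fun u ↦ (h ^ ⌊u⌋) (g (Int.fract u))
  have hc (n : ℤ) : ∀ u ∈ Icc (n : ℝ) (n + 1), c u = (h ^ n) (g (u - n)) := fun u hu ↦ by
    rcases hu.2.lt_or_eq with hlt | rfl
    · simp only [c, ← Int.self_sub_floor, Int.floor_eq_iff.2 ⟨hu.1, hlt⟩]
    · simp [c, hg1, zpow_add_one]
  refine ⟨c, ?_, fun u ↦ ?_, fun u hu ↦ by simpa using hc 0 u (by simpa using hu)⟩
  · refine LocallyFinite.continuous (f := fun n : ℤ ↦ Icc (n : ℝ) (n + 1)) ?_ ?_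
      (fun _ ↦ isClosed_Icc) fun n ↦ ?_
    · intro u
      refine ⟨Ioo (u - 1) (u + 1), Ioo_mem_nhds (by linarith) (by linarith),
        (Set.finite_Icc (⌊u⌋ - 2) (⌊u⌋ + 2)).subset ?_⟩
      rintro n ⟨v, ⟨h1, h2⟩, h3, h4⟩
      have := Int.floor_le u
      have := Int.lt_floor_add_one u
      constructor
      · have : (⌊u⌋ : ℝ) < n + 2 := by linarith
        have : ⌊u⌋ < n + 2 := by exact_mod_cast this
        omega
      · have : (n : ℝ) < ⌊u⌋ + 2 := by linarith
        have : n < ⌊u⌋ + 2 := by exact_mod_cast this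
        omega
    · exact Set.iUnion_eq_univ_iff.2 fun u ↦ ⟨⌊u⌋, Int.floor_le u, (Int.lt_floor_add_one u).le⟩
    · refine ContinuousOn.congr ?_ (hc n)
      refine (h ^ n).continuous.comp_continuousOn (hg.comp (by fun_prop) fun u hu ↦ ?_)
      exact ⟨by linarith [hu.1], by linarith [hu.2]⟩
  · simp only [c, Int.floor_add_one, Int.fract_add_one, add_comm ⌊u⌋, zpow_one_add]
    rfl

/-- The equivariant curve generated by a translation arc, together with its basic
non-intersection properties. -/
theorem IsTranslationArc.exists_curve {Y : Type*} [TopologicalSpace Y] {h : Y ≃ₜ Y} {γ : Set Y}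
    {x : Y} (harc : IsTranslationArc h γ x) :
    ∃ c : ℝ → Y, Continuous c ∧ (∀ u, c (u + 1) = h (c u)) ∧ γ = c '' Icc 0 1 ∧
      InjOn c (Icc 0 1) ∧ ∀ u v, 0 ≤ u → u < 1 → 1 ≤ v → v < 2 → c u ≠ c v := by
  obtain ⟨hx, g, hg, hginj, hg0, hg1, hγ, hint⟩ := harc
  obtain ⟨c, hc, hc1, hcg⟩ := exists_equivariant_curve h hg (by rw [hg0, hg1])
  have hinj : InjOn c (Icc 0 1) := fun a ha b hb hab ↦
    hginj ha hb (by rwa [← hcg a ha, ← hcg b hb])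
  have hγc : γ = c '' Icc 0 1 := hγ.trans (image_congr hcg).symm
  have h0 : (0 : ℝ) ∈ Icc (0 : ℝ) 1 := by simp
  have h1 : (1 : ℝ) ∈ Icc (0 : ℝ) 1 := by simp
  have hc0x : c 0 = x := by rw [hcg 0 h0, hg0]
  have hc1x : c 1 = h x := by rw [hcg 1 h1, hg1]
  refine ⟨c, hc, hc1, hγc, hinj, fun u v hu0 hu1 hv1 hv2 huv ↦ ?_⟩
  have hu : u ∈ Icc (0 : ℝ) 1 := ⟨hu0, hu1.le⟩
  have hv : v - 1 ∈ Icc (0 : ℝ) 1 := ⟨by linarith, by linarith⟩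
  have hvc : c v = h (c (v - 1)) := by rw [← hc1, sub_add_cancel]
  have hmem : c u ∈ h '' γ ∩ γ := by
    rw [hγc]
    exact ⟨⟨_, mem_image_of_mem c hv, by rw [← hvc, huv]⟩, mem_image_of_mem c hu⟩
  have hne1 : c u ≠ h x := fun he ↦ by
    have := hinj hu h1 (he.trans hc1x.symm)
    linarith
  rcases hint with hint | ⟨hint, hper⟩
  · rw [hint] at hmem
    exact hne1 hmem
  · rw [hint] at hmem
    have hux : c u = x := hmem.resolve_right hne1
    have := hinj hv h1 (h.injective (by rw [← hvc, ← huv, hux, hc1x, hper]))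
    linarith

/-- A simple closed arc `c '' [t, s]` of an equivariant curve carries an essential loop in the
complement of the fixed point set. -/
theorem IsOrientationPreserving.exists_essential_loop {h : (ℝ × ℝ) ≃ₜ (ℝ × ℝ)} (hor : IsOrientationPreserving h)
    {c : ℝ → ℝ × ℝ} (hc : Continuous c) (hc1 : ∀ u, c (u + 1) = h (c u))
    (hfix : ∀ u, h (c u) ≠ c u) {t s : ℝ} (hts : t + 1 < s)
    (hinj : ∀ u v, t ≤ u → u < v → v ≤ s → v - u < s - t → c u ≠ c v) (hclosed : c t = c s)
    (hQ : ∀ a b : ℝ, 0 ≤ b → b ≤ a → a ≤ 1 →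
      c ((1 - a) * (s - 1) + a * (t + 1)) ≠ c ((1 - b) * (s - 1) + b * (t + 1) + 1)) :
    ∃ (z : ↥{y : ℝ × ℝ | h y ≠ y}) (δ : Path z z),
      (∀ a, (δ a : ℝ × ℝ) ∈ c '' Icc t s) ∧ ¬δ.Homotopic (Path.refl z) := by
  obtain ⟨H, hH, hH0, hH1, hHh⟩ := hor
  let e : (ℝ × ℝ) ≃L[ℝ] ℂ := Complex.equivRealProdCLM.symm
  obtain ⟨ω, hω, hωexp⟩ := (convex_univ (𝕜 := ℝ) (E := ℝ)).exists_continuousOn_exp_eq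
    (f := fun u ↦ e (c (u + 1)) - e (c u)) (by fun_prop)
    (fun u _ ↦ sub_ne_zero.2 fun he ↦ hfix u (by rw [← hc1]; exact e.injective he))
  rw [continuousOn_univ] at hω
  simp only [mem_univ, true_imp_iff] at hωexp
  let G : ℝ × ℝ → ℂ := fun p ↦ e (H (projIcc 0 1 zero_le_one p.1, c p.2))
  have hG0 : ∀ u, G (0, u) = e (c u) := fun u ↦ by
    simp only [G, projIcc_left]
    exact congr_arg e (hH0 _)
  have hG1 : ∀ u, G (1, u) = e (c (u + 1)) := fun u ↦ by
    simp only [G, projIcc_right, hc1]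
    exact congr_arg e (hH1 _)
  have hne : ω s ≠ ω t := by
    refine displacement_log_ne (G := G) ?_ hts ?_ ?_ ?_ ?_ hω ?_
    · have := continuous_projIcc (a := (0 : ℝ)) (b := 1) (h := zero_le_one)
      fun_prop
    · intro τ _ u v h1 h2 h3 h4 he
      exact hinj u v h1 h2 h3 h4 ((hHh _).injective (e.injective he))
    · intro τ _
      simp only [G, hclosed]
    · intro u
      rw [hG0, hG1]
    · intro a b h1 h2 h3 he
      rw [hG0, hG0] at he
      exact hQ a b h1 h2 h3 (e.injective he)
    · intro u
      rw [hωexp, hG0, hG0]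
  let δ : Path (⟨c t, hfix t⟩ : ↥{y : ℝ × ℝ | h y ≠ y}) ⟨c t, hfix t⟩ :=
    { toFun := fun a ↦ ⟨c (t + a * (s - t)), hfix _⟩
      continuous_toFun := by fun_prop
      source' := by simp
      target' := by simp [hclosed] }
  refine ⟨_, δ, fun a ↦ ⟨t + a * (s - t), ⟨?_, ?_⟩, rfl⟩, fun hδ ↦ hne ?_⟩
  · nlinarith [a.2.1]
  · nlinarith [a.2.2]
  · have := hδ.exp_lift_eq (φ := fun y ↦ e (h y) - e y) (by fun_prop)
      (fun y ↦ sub_ne_zero.2 fun he ↦ y.2 (e.injective he))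
      (ω := fun a ↦ ω (t + a * (s - t))) (by fun_prop)
      (fun a ↦ by rw [hωexp, hc1]; rfl)
    simpa using this

/-- Brouwer-type dichotomy: a translation arc `γ` for an
orientation-preserving homeomorphism `h` of the plane is, for each `N ≥ 1`, either an
`N`-translation arc, or `⋃_{k ≤ N} h^k(γ)` contains a loop which is homotopically
nontrivial in `ℝ² ∖ Fix(h)`. -/
theorem brouwer_translation_arc_dichotomy
    (h : (ℝ × ℝ) ≃ₜ (ℝ × ℝ)) (hor : IsOrientationPreserving h)
    (γ : Set (ℝ × ℝ)) (x : ℝ × ℝ) (harc : IsTranslationArc h γ x)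
    (N : ℕ) (hN : 1 ≤ N) :
    IsNTranslationArc h N γ x ∨
      ∃ (z : ↥{y : ℝ × ℝ | h y ≠ y}) (δ : Path z z),
        (∀ t : unitInterval, (↑(δ t) : ℝ × ℝ) ∈ ⋃ k ∈ Set.Iic N, (⇑h)^[k] '' γ) ∧
          ¬δ.Homotopic (Path.refl z) := by
  obtain ⟨c, hc, hc1, hγ, hinj, hdisj⟩ := harc.exists_curve
  have hcn (n : ℕ) (u : ℝ) : c (u + n) = h^[n] (c u) := by
    induction n with
    | zero => simp
    | succ n ih => rw [Nat.cast_succ, ← add_assoc, hc1, ih, Function.iterate_succ_apply']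
  have hfix : ∀ u, h (c u) ≠ c u := by
    have hstep : ∀ u, h (c (u + 1)) = c (u + 1) ↔ h (c u) = c u := fun u ↦ by
      rw [hc1]; exact h.injective.eq_iff
    intro u
    have hz : ∀ n : ℤ, h (c (Int.fract u + n)) ≠ c (Int.fract u + n) := by
      intro n
      induction n with
      | zero =>
        rw [Int.cast_zero, add_zero, ← hc1]
        exact (hdisj _ _ (Int.fract_nonneg u) (Int.fract_lt_one u)
          (by linarith [Int.fract_nonneg u]) (by linarith [Int.fract_lt_one u])).symm
      | succ n ih => rwa [Int.cast_add, Int.cast_one, ← add_assoc, Ne, hstep]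
      | pred n ih =>
        rwa [Ne, ← hstep, add_assoc, Int.cast_sub, Int.cast_one, sub_add_cancel]
    simpa using hz ⌊u⌋
  let K : Set (ℝ × ℝ) := (Icc 0 1 ×ˢ Icc 2 ((N : ℝ) + 1)) ∩ {p | c p.1 = c p.2}
  have hK : IsCompact K := (isCompact_Icc.prod isCompact_Icc).inter_right
    (isClosed_eq (by fun_prop) (by fun_prop))
  rcases K.eq_empty_or_nonempty with hKe | hKne
  · left
    have hempty : ∀ k : ℕ, 2 ≤ k → k ≤ N → h^[k] '' γ ∩ γ = ∅ := by
      intro k hk2 hkN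
      rw [Set.eq_empty_iff_forall_notMem, hγ]
      rintro _ ⟨⟨_, ⟨v, hv, rfl⟩, rfl⟩, u, hu, huv⟩
      have hk2' : (2 : ℝ) ≤ k := by exact_mod_cast hk2
      have hkN' : (k : ℝ) ≤ N := by exact_mod_cast hkN
      have : (u, v + k) ∈ K :=
        ⟨⟨hu, by linarith [hv.1], by linarith [hv.2]⟩, by rw [mem_ofPred_eq, hcn, huv]⟩
      rw [hKe] at this
      exact this
    exact ⟨harc, fun hN2 ↦ ⟨fun k hk2 hkN ↦ hempty k hk2 (by omega), .inl (hempty N hN2 le_rfl)⟩⟩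
  · right
    obtain ⟨⟨t, s⟩, ⟨⟨ht, hs⟩, hclosed⟩, hmin⟩ := hK.exists_isMinOn hKne continuous_snd.continuousOn
    simp only [mem_ofPred_eq] at ht hs hclosed
    have hmin' : ∀ u v : ℝ, u ∈ Icc (0 : ℝ) 1 → 2 ≤ v → v ≤ N + 1 → c u = c v → s ≤ v :=
      fun u v hu h2 hN huv ↦ hmin (a := (u, v)) ⟨⟨hu, h2, hN⟩, huv⟩
    have ht1 : t < 1 := by
      refine ht.2.lt_of_ne fun h1 ↦ ?_
      have h0s : c 0 = c (s - 1) := h.injective (by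
        rw [← hc1, ← hc1, zero_add, sub_add_cancel, ← h1, hclosed])
      rcases lt_or_ge (s - 1) 2 with h2 | h2
      · exact hdisj 0 (s - 1) le_rfl one_pos (by linarith [hs.1]) h2 h0s
      · linarith [hmin' 0 (s - 1) (by simp) h2 (by linarith [hs.2]) h0s]
    have hsimple : ∀ u v, t ≤ u → u < v → v ≤ s → v - u < s - t → c u ≠ c v := by
      intro u v htu huv hvs hlt he
      have hu0 : 0 ≤ u := ht.1.trans htu
      have hn1 := Nat.floor_le hu0
      have hn2 := Nat.lt_floor_add_one u
      have hu' : u - ⌊u⌋₊ ∈ Icc (0 : ℝ) 1 := ⟨by linarith, by linarith⟩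
      have he' : c (u - ⌊u⌋₊) = c (v - ⌊u⌋₊) := h.injective.iterate ⌊u⌋₊ (by
        rw [← hcn, ← hcn, sub_add_cancel, sub_add_cancel, he])
      rcases le_or_gt (v - ⌊u⌋₊) 1 with hv1 | hv1
      · linarith [hinj hu' ⟨by linarith, hv1⟩ he']
      rcases lt_or_ge (v - ⌊u⌋₊) 2 with hv2 | hv2
      · exact hdisj _ _ hu'.1 (by linarith) hv1.le hv2 he'
      · have := hmin' _ _ hu' hv2 (by linarith [hs.2]) he'
        have hvs' : v - ⌊u⌋₊ = s := by linarith
        have := hinj hu' ht (by rw [he', hvs', hclosed])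
        linarith
    obtain ⟨z, δ, hδ, hδ'⟩ := hor.exists_essential_loop hc hc1 hfix
      (t := t) (s := s) (by linarith [hs.1]) hsimple hclosed (by
        intro a b hb hba ha he
        have hst : 0 < s - 1 - t := by linarith [hs.1]
        rcases le_or_gt 2 (s - t) with h2 | h2
        · refine hsimple _ _ ?_ ?_ ?_ ?_ he <;> nlinarith
        · refine hdisj ((1 - a) * (s - 1) + a * (t + 1) - 1)
            ((1 - b) * (s - 1) + b * (t + 1)) ?_ ?_ ?_ ?_ (h.injective ?_)
          · nlinarith [hs.1, ht.1]
          · nlinarith [hs.1, ht.1]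
          · nlinarith [hs.1, ht.1]
          · nlinarith [hs.1, ht.1]
          · rw [← hc1, ← hc1, sub_add_cancel, he])
    refine ⟨z, δ, fun a ↦ ?_, hδ'⟩
    obtain ⟨u, hu, hua⟩ := hδ a
    rw [← hua, hγ]
    have hu0 : 0 ≤ u := ht.1.trans hu.1
    simp only [mem_iUnion, mem_Iic, exists_prop]
    rcases (hu.2.trans hs.2).lt_or_eq with hlt | heq
    · have hn1 := Nat.floor_le hu0
      have hn2 := Nat.lt_floor_add_one u
      have : ⌊u⌋₊ < N + 1 := by
        have : (⌊u⌋₊ : ℝ) < N + 1 := by linarith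
        exact_mod_cast this
      exact ⟨⌊u⌋₊, by omega, c (u - ⌊u⌋₊), ⟨_, ⟨by linarith, by linarith⟩, rfl⟩,
        by rw [← hcn, sub_add_cancel]⟩
    · exact ⟨N, le_rfl, c 1, ⟨1, by simp, rfl⟩, by rw [← hcn, heq, add_comm]⟩

end
end

section
/- Let g ≥ 0 be an integer, F an orientation-preserving homeomorphism of ℝ/ℤ with rotation number α ≠ 0, and q = q(α,g). If (ξ_i)_{i∈ℤ} is an orbit of F (ξ_{i+1} = F(ξ_i)) that is not periodic, then the 4g+4 points ξ_0, ξ_q, ξ_{2q}, …, ξ_{(2g+1)q}, ξ_1, ξ_{q+1}, ξ_{2q+1}, …, ξ_{(2g+1)q+1} are pairwise distinct and are cyclically ordered in ℝ/ℤ, in this order or in the reversed order: there exist real numbers t_0 < t_1 < ⋯ < t_{4g+3} < t_0 + 1 projecting modulo ℤ, in order, to this list of points (or to its reversal). -/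
open Set Topology Filter

noncomputable section

universe u

variable {X : Type u} [TopologicalSpace X]

/-- The index sequence `ξ_0, ξ_q, …, ξ_{(2g+1)q}, ξ_1, ξ_{q+1}, …, ξ_{(2g+1)q+1}`. -/
def orbitIndex (g q : ℕ) (j : Fin (4 * g + 4)) : ℤ :=
  if (j : ℕ) < 2 * g + 2 then ((j : ℕ) : ℤ) * (q : ℤ)
  else (((j : ℕ) : ℤ) - ((2 * g + 2 : ℕ) : ℤ)) * (q : ℤ) + 1

/-- Comparing translation numbers compares the corresponding points of every orbit of a lift. -/
theorem CircleDeg1Lift.iterate_add_int_lt_of_translationNumber (G : CircleDeg1Lift) {i j : ℕ}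
    {k : ℤ} (h : i * G.translationNumber + k < j * G.translationNumber) (x : ℝ) :
    G^[i] x + k < G^[j] x := by
  by_contra! hle
  rcases le_total i j with hij | hij
  · obtain ⟨d, rfl⟩ := Nat.exists_eq_add_of_le' hij
    rw [Function.iterate_add_apply, ← CircleDeg1Lift.coe_pow G d] at hle
    have := CircleDeg1Lift.translationNumber_le_of_le_add_int _ hle
    rw [CircleDeg1Lift.translationNumber_pow] at this
    push_cast at h
    linarith
  · obtain ⟨d, rfl⟩ := Nat.exists_eq_add_of_le' hij
    rw [Function.iterate_add_apply, ← CircleDeg1Lift.coe_pow G d] at hle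
    have := CircleDeg1Lift.le_translationNumber_of_add_int_le (m := -k) (G ^ d)
      (x := G^[j] x) (by push_cast; linarith)
    rw [CircleDeg1Lift.translationNumber_pow] at this
    push_cast at h this
    linarith

theorem CircleDeg1Lift.iterate_add_intCast (G : CircleDeg1Lift) (n : ℕ) (x : ℝ) (k : ℤ) :
    G^[n] (x + k) = G^[n] x + k := by
  rw [← CircleDeg1Lift.coe_pow, CircleDeg1Lift.map_add_int]

theorem CircleDeg1Lift.coe_iterate_eq {F : AddCircle (1 : ℝ) → AddCircle (1 : ℝ)}
    {G : CircleDeg1Lift} (hGlift : ∀ x : ℝ, F (x : AddCircle (1 : ℝ)) = (G x : AddCircle (1 : ℝ)))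
    {ξ : ℤ → AddCircle (1 : ℝ)} (horb : ∀ i : ℤ, ξ (i + 1) = F (ξ i)) {x : ℝ}
    (hx : (x : AddCircle (1 : ℝ)) = ξ 0) (n : ℕ) :
    ((G^[n] x : ℝ) : AddCircle (1 : ℝ)) = ξ n := by
  induction n with
  | zero => simpa using hx
  | succ n ih =>
    rw [Function.iterate_succ_apply', ← hGlift, ih, Nat.cast_succ, horb]

theorem UnitAddCircle.coe_sub_intCast (x : ℝ) (m : ℤ) :
    ((x - m : ℝ) : AddCircle (1 : ℝ)) = x := by
  rw [AddCircle.coe_sub, sub_eq_self, AddCircle.coe_eq_zero_iff]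
  exact ⟨m, by simp⟩

theorem UnitAddCircle.norm_le_abs_sub_intCast (x : ℝ) (m : ℤ) :
    ‖(x : AddCircle (1 : ℝ))‖ ≤ |x - m| := by
  have h := UnitAddCircle.norm_eq (x := x)
  exact h.le.trans (round_le x m)

theorem qConst_pos_and_norm_lt {α : AddCircle (1 : ℝ)} (hα : α ≠ 0) (g : ℕ) :
    0 < qConst α g ∧ ((2 * g + 1 : ℕ) : ℝ) * ‖qConst α g • α‖ < ‖α‖ := by
  have hpos : 0 < ‖α‖ := norm_pos_iff.mpr hα
  have hne : {q : ℕ | 0 < q ∧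
      ((IsRationalAC α ∧ ‖q • α‖ = 0) ∨
        (¬IsRationalAC α ∧ ((2 * g + 1 : ℕ) : ℝ) * ‖q • α‖ < ‖α‖))}.Nonempty := by
    by_cases hr : IsRationalAC α
    · obtain ⟨r, rfl⟩ := hr
      refine ⟨r.den, r.den_pos, Or.inl ⟨⟨r, rfl⟩, ?_⟩⟩
      rw [norm_eq_zero, ← AddCircle.coe_nsmul, AddCircle.coe_eq_zero_iff]
      refine ⟨r.num, ?_⟩
      rw [zsmul_one, nsmul_eq_mul]
      exact_mod_cast (Rat.den_mul_eq_num r).symm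
    · obtain ⟨n, hn⟩ := exists_nat_gt (((2 * g + 1 : ℕ) : ℝ) / ‖α‖)
      have hn0 : 0 < n := by
        have : (0 : ℝ) < n := lt_of_le_of_lt (by positivity) hn
        exact_mod_cast this
      obtain ⟨j, hj, hle⟩ := AddCircle.exists_norm_nsmul_le α hn0
      refine ⟨j, hj.1, Or.inr ⟨hr, ?_⟩⟩
      rw [div_lt_iff₀ hpos] at hn
      calc ((2 * g + 1 : ℕ) : ℝ) * ‖j • α‖
          ≤ ((2 * g + 1 : ℕ) : ℝ) * (1 / ((n : ℝ) + 1)) := by gcongr; exact_mod_cast hle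
        _ < ‖α‖ := by
          rw [mul_one_div, div_lt_iff₀ (by positivity)]
          linarith
  obtain ⟨h0, ⟨-, h⟩ | ⟨-, h⟩⟩ := Nat.sInf_mem hne
  · refine ⟨h0, ?_⟩
    rw [show ‖qConst α g • α‖ = 0 from h, mul_zero]
    exact hpos
  · exact ⟨h0, h⟩

/-- Two strictly monotone sequences, the first `n` terms of one followed by the other. -/
theorem strictMono_ite_of_lt {a b : ℕ → ℝ} (ha : StrictMono a) (hb : StrictMono b) {n : ℕ}
    (hab : a n < b 0) : StrictMono fun j => if j < n + 1 then a j else b (j - (n + 1)) := by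
  refine strictMono_nat_of_lt_succ fun j => ?_
  rcases lt_trichotomy j n with h | rfl | h
  · simpa [show j < n + 1 by omega, h] using ha (Nat.lt_succ_self j)
  · simpa using hab
  · simp only [show ¬ j < n + 1 by omega, show ¬ j + 1 < n + 1 by omega, if_false]
    exact hb (by omega)

theorem coe_ne_coe_of_strictMono {n : ℕ} {t : Fin (n + 1) → ℝ} (ht : StrictMono t)
    (hlast : t (Fin.last n) < t 0 + 1) {i j : Fin (n + 1)} (hij : i ≠ j) :
    (t i : AddCircle (1 : ℝ)) ≠ t j := by
  have hmem : ∀ i, t i ∈ Ico (t 0) (t 0 + 1) := fun i =>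
    ⟨ht.monotone (Fin.zero_le i), (ht.monotone (Fin.le_last i)).trans_lt hlast⟩
  rw [Ne, AddCircle.coe_eq_coe_iff_of_mem_Ico (hmem i) (hmem j)]
  exact fun h => hij (ht.injective h)

/-- For an orientation-preserving circle homeomorphism `F` with rotation
number `α ≠ 0` and `q = q(α,g)`, any non-periodic orbit `(ξ_i)` gives `4g+4` pairwise
distinct points `ξ_0, ξ_q, …, ξ_{(2g+1)q}, ξ_1, ξ_{q+1}, …, ξ_{(2g+1)q+1}` which are
cyclically ordered in `ℝ/ℤ`, in this order or in the reversed one. -/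
theorem cyclic_order_of_orbit
    (g : ℕ) (F : AddCircle (1 : ℝ) ≃ₜ AddCircle (1 : ℝ))
    (G : CircleDeg1Lift) (hGmono : StrictMono ⇑G) (hGcont : Continuous ⇑G)
    (hGlift : ∀ x : ℝ, F ((x : ℝ) : AddCircle (1 : ℝ)) = ((G x : ℝ) : AddCircle (1 : ℝ)))
    (α : AddCircle (1 : ℝ)) (hα : ((G.translationNumber : ℝ) : AddCircle (1 : ℝ)) = α)
    (hα0 : α ≠ 0)
    (ξ : ℤ → AddCircle (1 : ℝ)) (horb : ∀ i : ℤ, ξ (i + 1) = F (ξ i))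
    (hnonper : ∀ n : ℕ, 1 ≤ n → ξ (n : ℤ) ≠ ξ 0) :
    (∀ i j : Fin (4 * g + 4), i ≠ j →
        ξ (orbitIndex g (qConst α g) i) ≠ ξ (orbitIndex g (qConst α g) j)) ∧
      ∃ t : Fin (4 * g + 4) → ℝ, StrictMono t ∧
        t ⟨4 * g + 3, by omega⟩ < t ⟨0, by omega⟩ + 1 ∧
        ((∀ j : Fin (4 * g + 4),
            ((t j : ℝ) : AddCircle (1 : ℝ)) = ξ (orbitIndex g (qConst α g) j)) ∨
          (∀ j : Fin (4 * g + 4),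
            ((t j : ℝ) : AddCircle (1 : ℝ)) = ξ (orbitIndex g (qConst α g) j.rev))) := by
  obtain ⟨hq, hN⟩ := qConst_pos_and_norm_lt hα0 g
  set q := qConst α g
  set N := 2 * g + 1
  set τ := G.translationNumber with hτ
  set p := round ((q : ℝ) * τ)
  set m := ⌊τ⌋
  obtain ⟨x, hx⟩ := QuotientAddGroup.mk_surjective (ξ 0)
  replace hx : (x : AddCircle (1 : ℝ)) = ξ 0 := hx
  have hξ := CircleDeg1Lift.coe_iterate_eq (F := F) hGlift horb hx
  have hδ : (N : ℝ) * |q * τ - p| < ‖α‖ := by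
    have h : ‖q • α‖ = |q * τ - p| := by
      rw [← hα, ← AddCircle.coe_nsmul, nsmul_eq_mul]
      exact UnitAddCircle.norm_eq
    rwa [h] at hN
  have hδ' : |(N : ℝ) * (q * τ - p)| < ‖α‖ := by
    rwa [abs_mul, abs_of_nonneg (Nat.cast_nonneg N)]
  have hm0 : ‖α‖ ≤ τ - m := by
    have h := UnitAddCircle.norm_le_abs_sub_intCast τ m
    rwa [hα, abs_of_nonneg (sub_nonneg.mpr (Int.floor_le τ))] at h
  have hm1 : ‖α‖ ≤ m + 1 - τ := by
    have h := UnitAddCircle.norm_le_abs_sub_intCast τ (m + 1)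
    push_cast at h
    rwa [hα, abs_sub_comm, abs_of_nonneg (sub_nonneg.mpr (Int.lt_floor_add_one τ).le)] at h
  obtain ⟨hδl, hδu⟩ := abs_lt.mp hδ'
  -- the lifts of the two blocks of orbit points
  let a : ℕ → ℝ := fun k => G^[k * q] x - ((k * p : ℤ) : ℝ)
  let b : ℤ → ℕ → ℝ := fun c k => G^[k * q + 1] x - ((k * p + c : ℤ) : ℝ)
  let s : ℤ → ℕ → ℝ := fun c j => if j < N + 1 then a j else b c (j - (N + 1))
  have hs : ∀ (c : ℤ) (j : Fin (4 * g + 4)),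
      ((s c j : ℝ) : AddCircle (1 : ℝ)) = ξ (orbitIndex g q j) := by
    intro c j
    by_cases hj : (j : ℕ) < N + 1
    · simp only [s, a, hj, if_true, UnitAddCircle.coe_sub_intCast, hξ, orbitIndex,
        show (j : ℕ) < 2 * g + 2 from hj]
      push_cast
      rfl
    · simp only [s, b, hj, if_false, UnitAddCircle.coe_sub_intCast, hξ, orbitIndex,
        show ¬ (j : ℕ) < 2 * g + 2 from hj]
      push_cast [show N + 1 ≤ (j : ℕ) by omega]
      congr 3
  have hG : ∀ n : ℕ, StrictMono G^[n] := fun n => hGmono.iterate n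
  have hstep : ∀ n : ℕ, G^[n + q] x - p = G^[n] (G^[q] x + ((-p : ℤ) : ℝ)) := fun n => by
    rw [CircleDeg1Lift.iterate_add_intCast, Function.iterate_add_apply]
    push_cast
    ring
  have ha_succ : ∀ k, a (k + 1) = G^[k * q] (G^[q] x + ((-p : ℤ) : ℝ)) - ((k * p : ℤ) : ℝ) :=
    fun k => by
      rw [← hstep]
      simp only [a, add_one_mul]
      push_cast
      ring
  have hb_succ : ∀ c k, b c (k + 1) =
      G^[k * q + 1] (G^[q] x + ((-p : ℤ) : ℝ)) - ((k * p + c : ℤ) : ℝ) := fun c k => by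
    rw [← hstep]
    simp only [b, add_one_mul, add_right_comm _ q 1]
    push_cast
    ring
  have hne : G^[q] x + ((-p : ℤ) : ℝ) ≠ x := fun h => by
    apply hnonper q hq
    rw [← hξ, ← hx, ← UnitAddCircle.coe_sub_intCast _ p]
    congr 1
    push_cast at h
    linarith
  have hcmp := fun {i j : ℕ} {k : ℤ} =>
    G.iterate_add_int_lt_of_translationNumber (i := i) (j := j) (k := k)
  rw [← hτ] at hcmp
  suffices h : ∃ t : Fin (4 * g + 3 + 1) → ℝ, StrictMono t ∧ t (Fin.last _) < t 0 + 1 ∧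
      ((∀ j, ((t j : ℝ) : AddCircle (1 : ℝ)) = ξ (orbitIndex g q j)) ∨
        (∀ j, ((t j : ℝ) : AddCircle (1 : ℝ)) = ξ (orbitIndex g q j.rev))) by
    refine ⟨fun i j hij => ?_, h⟩
    obtain ⟨t, ht, hlast, h | h⟩ := h
    · rw [← h i, ← h j]
      exact coe_ne_coe_of_strictMono ht hlast hij
    · rw [← Fin.rev_rev i, ← Fin.rev_rev j, ← h, ← h]
      exact coe_ne_coe_of_strictMono ht hlast (Fin.rev_injective.ne hij)
  have h_end : ¬ 4 * g + 3 < N + 1 := by omega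
  have h_end' : 4 * g + 3 - (N + 1) = N := by omega
  rcases lt_or_gt_of_ne hne with hlt | hgt
  · have ha : StrictMono (fun k => -a k) := strictMono_nat_of_lt_succ fun k => by
      rw [neg_lt_neg_iff, ha_succ]
      exact sub_lt_sub_right (hG _ hlt) _
    have hb : StrictMono (fun k => -b (m + 1) k) := strictMono_nat_of_lt_succ fun k => by
      rw [neg_lt_neg_iff, hb_succ]
      exact sub_lt_sub_right (hG _ hlt) _
    have hab : -a N < -b (m + 1) 0 := by
      have := hcmp (i := 1) (j := N * q) (k := N * p - (m + 1)) (by push_cast; linarith) x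
      simp only [a, b, zero_mul, zero_add]
      push_cast at this ⊢
      linarith
    have hmono := strictMono_ite_of_lt ha hb hab
    have hs_eq : ∀ j, (if j < N + 1 then -a j else -b (m + 1) (j - (N + 1))) = -s (m + 1) j :=
      fun j => by simp only [s]; split_ifs <;> rfl
    simp only [hs_eq] at hmono
    refine ⟨fun j => s (m + 1) j.rev, fun i j hij => ?_, ?_, Or.inr fun j => hs _ _⟩
    · exact neg_lt_neg_iff.mp (hmono (Fin.rev_lt_rev.mpr hij))
    · have := hcmp (i := 0) (j := N * q + 1) (k := N * p + m) (by push_cast; linarith) x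
      simp only [s, a, b, Fin.rev_last, Fin.rev_zero, Fin.val_zero, Fin.val_last, h_end, h_end',
        Nat.succ_pos, if_true, if_false]
      push_cast at this ⊢
      simp only [zero_mul, Function.iterate_zero, id] at this ⊢
      linarith
  · have ha : StrictMono a := strictMono_nat_of_lt_succ fun k => by
      rw [ha_succ]
      exact sub_lt_sub_right (hG _ hgt) _
    have hb : StrictMono (b m) := strictMono_nat_of_lt_succ fun k => by
      rw [hb_succ]
      exact sub_lt_sub_right (hG _ hgt) _
    have hab : a N < b m 0 := by
      have := hcmp (i := N * q) (j := 1) (k := m - N * p) (by push_cast; linarith) x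
      simp only [a, b, zero_mul, zero_add]
      push_cast at this ⊢
      linarith
    have hmono : StrictMono (s m) := strictMono_ite_of_lt ha hb hab
    refine ⟨fun j => s m j, fun i j hij => hmono hij, ?_, Or.inl fun j => hs _ _⟩
    have := hcmp (i := N * q + 1) (j := 0) (k := -(N * p + m + 1)) (by push_cast; linarith) x
    simp only [s, a, b, Fin.val_zero, Fin.val_last, h_end, h_end',
      Nat.succ_pos, if_true, if_false]
    push_cast at this ⊢
    simp only [zero_mul, Function.iterate_zero, id] at this ⊢
    linarith

end
end
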